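/- Let A ⊆ B be a (φ,ψ)-bounded extension of the multi-filtered K-algebra A. Then for all γ, δ ∈ ℕ^n one has F̃_γ(B) · F̃_δ(B) ⊆ F̃_{γ+δ}(B). -/

import Mathlib

open scoped BigOperators

/-- Multi-indices: elements of `ℕ^n`. -/
abbrev MIdx (n : ℕ) := Fin n → ℕ

/-- An admissible order on `ℕ^n`: a total order compatible with addition and having `0` as
least element. -/
structure AdmOrder (n : ℕ) where
  le : MIdx n → MIdx n → Prop
  le_refl : ∀ a, le a a
  le_trans : ∀ {a b c}, le a b → le b c → le a c
  le_antisymm : ∀ {a b}, le a b → le b a → a = b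
  le_total : ∀ a b, le a b ∨ le b a
  add_right : ∀ {a b : MIdx n} (c : MIdx n), le a b → le (a + c) (b + c)
  zero_le : ∀ a, le 0 a

/-- The strict order associated to an admissible order. -/
def AdmOrder.lt {n : ℕ} (o : AdmOrder n) (a b : MIdx n) : Prop :=
  o.le a b ∧ a ≠ b

/-- The ordered standard monomial `x^β = x₁^{β₁} ⋯ x_s^{β_s}`. -/
def smon {B : Type*} [Monoid B] {s : ℕ} (x : Fin s → B) (β : MIdx s) : B :=
  (List.ofFn fun i => x i ^ β i).prod

/-- The `K`-submodule `Σ_{γ with P γ} F_{γ₁}(A)·x^{γ₂}` of `B`. -/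
def monSum (K : Type*) [CommRing K] (B : Type*) [Ring B] [Algebra K B]
    {m s : ℕ} (F : MIdx m → Submodule K B) (x : Fin s → B)
    (P : MIdx m × MIdx s → Prop) : Submodule K B :=
  ⨆ γ ∈ {γ : MIdx m × MIdx s | P γ},
    (F γ.1).map (LinearMap.mulRight K (smon x γ.2))

/-- A `(φ,ψ)`-bounded extension `A ⊆ B` of a multi-filtered `K`-algebra `A`, where `A` is
realized as a subalgebra of `B` carrying an `(ℕ^m,⪯₁)`-filtration `F`, and `B` is generated
over `A` by elements `x 1, …, x s`, subject to the axioms (EA1)–(EA4). -/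
structure BoundedExt (K : Type*) [CommRing K] (B : Type*) [Ring B] [Algebra K B]
    (m s n : ℕ) where
  /-- admissible order `⪯₁` on `ℕ^m` -/
  o1 : AdmOrder m
  /-- admissible order `⪯₂` on `ℕ^s` -/
  o2 : AdmOrder s
  /-- admissible order `⪯` on `ℕ^n` -/
  o : AdmOrder n
  /-- the monoid morphism `φ : ℕ^m → ℕ^n` -/
  φ : MIdx m →+ MIdx n
  /-- the monoid morphism `ψ : ℕ^s → ℕ^n` -/
  ψ : MIdx s →+ MIdx n
  φ_mono : ∀ {a b : MIdx m}, o1.le a b → o.le (φ a) (φ b)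
  ψ_mono : ∀ {a b : MIdx s}, o2.le a b → o.le (ψ a) (ψ b)
  /-- the subalgebra `A` of `B` -/
  A : Subalgebra K B
  /-- (EA1): the `(ℕ^m,⪯₁)`-filtration on `A` -/
  F : MIdx m → Submodule K B
  F_le_A : ∀ a : MIdx m, F a ≤ Subalgebra.toSubmodule A
  F_mono : ∀ {a b : MIdx m}, o1.le a b → F a ≤ F b
  F_mul : ∀ {a b : MIdx m} {u v : B}, u ∈ F a → v ∈ F b → u * v ∈ F (a + b)
  F_exhaustive : ∀ u ∈ A, ∃ a : MIdx m, u ∈ F a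
  F_one : (1 : B) ∈ F 0
  /-- the generators `x_1, …, x_s` -/
  x : Fin s → B
  /-- (EA2): `B` is generated as a `K`-algebra by `A` and `x_1, …, x_s` -/
  gen : Algebra.adjoin K ((A : Set B) ∪ Set.range x) = ⊤
  /-- (EA3) -/
  EA3 : ∀ (i : Fin s) (α : MIdx m), ∀ a ∈ F α,
    x i * a ∈ (F α).map (LinearMap.mulRight K (x i)) ⊔
      monSum K B F x (fun γ => o.lt (φ γ.1 + ψ γ.2) (φ α + ψ (Pi.single i 1)))
  /-- (EA4) -/
  EA4 : ∀ i j : Fin s, i < j → ∃ q ∈ F 0,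
    x j * x i - q * (x i * x j) ∈
      monSum K B F x (fun γ => o.lt (φ γ.1 + ψ γ.2) (ψ (Pi.single i 1 + Pi.single j 1)))

namespace BoundedExt

variable {K : Type*} [CommRing K] {B : Type*} [Ring B] [Algebra K B] {m s n : ℕ}

/-- The weight `wt(γ) = φ(γ₁) + ψ(γ₂)` of a pair of multi-indices. -/
def wt (E : BoundedExt K B m s n) (γ : MIdx m × MIdx s) : MIdx n :=
  E.φ γ.1 + E.ψ γ.2

/-- The filtration `F̃_α(B) = Σ_{wt(γ) ⪯ α} F_{γ₁}(A)x^{γ₂}` on `B`. -/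
def tF (E : BoundedExt K B m s n) (α : MIdx n) : Submodule K B :=
  monSum K B E.F E.x (fun γ => E.o.le (E.wt γ) α)

/-- `F̃_{≺α}(B) = ⋃_{β ≺ α} F̃_β(B)`. -/
def tFlt (E : BoundedExt K B m s n) (α : MIdx n) : Submodule K B :=
  ⨆ β ∈ {β : MIdx n | E.o.lt β α}, E.tF β

/-- `F_{≺α}(A) = ⋃_{β ≺₁ α} F_β(A)`. -/
def Flt (E : BoundedExt K B m s n) (α : MIdx m) : Submodule K B :=
  ⨆ β ∈ {β : MIdx m | E.o1.lt β α}, E.F β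

/-- The strict order `≺'` on `ℕ^s × ℕ^n`: `(λ,ν) ≺' (λ',ν')` iff `ν ≺ ν'`, or `ν = ν'`
and `λ ≺₂ λ'`. -/
def ltP (E : BoundedExt K B m s n) (p q : MIdx s × MIdx n) : Prop :=
  E.o.lt p.2 q.2 ∨ (p.2 = q.2 ∧ E.o2.lt p.1 q.1)

end BoundedExt

namespace AdmOrder

variable {n : ℕ} (o : AdmOrder n)

theorem add_le_add {a b c d : MIdx n} (h₁ : o.le a b) (h₂ : o.le c d) :
    o.le (a + c) (b + d) := by
  refine o.le_trans (o.add_right c h₁) ?_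
  rw [add_comm b c, add_comm b d]
  exact o.add_right b h₂

theorem lt_add_right {a b : MIdx n} (c : MIdx n) (h : o.lt a b) : o.lt (a + c) (b + c) :=
  ⟨o.add_right c h.1, fun e => h.2 (add_right_cancel e)⟩

theorem lt_add_left {a b : MIdx n} (c : MIdx n) (h : o.lt a b) : o.lt (c + a) (c + b) := by
  rw [add_comm c a, add_comm c b]
  exact o.lt_add_right c h

theorem lt_trans {a b c : MIdx n} (h₁ : o.lt a b) (h₂ : o.lt b c) : o.lt a c :=
  ⟨o.le_trans h₁.1 h₂.1, fun e => h₁.2 (o.le_antisymm h₁.1 (e ▸ h₂.1))⟩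

/-- An admissible order extends the componentwise order. -/
theorem le_of_le {a b : MIdx n} (h : a ≤ b) : o.le a b := by
  have := o.add_right a (o.zero_le (b - a))
  rwa [zero_add, tsub_add_cancel_of_le h] at this

/-- Dickson's lemma: an admissible order is a well-order. -/
theorem wellFounded_lt : WellFounded o.lt := by
  have : IsStrictOrder (MIdx n) o.lt :=
    { irrefl := fun _ h => h.2 rfl, trans := fun _ _ _ => o.lt_trans }
  rw [RelEmbedding.wellFounded_iff_isEmpty]
  refine ⟨fun f => ?_⟩
  obtain ⟨i, j, hij, hle⟩ := wellQuasiOrdered_le (α := MIdx n) f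
  have hlt : o.lt (f j) (f i) := f.map_rel_iff.2 hij
  exact hlt.2 (o.le_antisymm hlt.1 (o.le_of_le hle))

end AdmOrder

/-- The exponent of a word in the letters `Fin s`. -/
def wordExp {s : ℕ} (L : List (Fin s)) : MIdx s :=
  (L.map fun i => (Pi.single i 1 : MIdx s)).sum

@[simp]
theorem wordExp_nil {s : ℕ} : wordExp ([] : List (Fin s)) = 0 := rfl

@[simp]
theorem wordExp_cons {s : ℕ} (i : Fin s) (L : List (Fin s)) :
    wordExp (i :: L) = Pi.single i 1 + wordExp L := by
  simp [wordExp]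

theorem wordExp_perm {s : ℕ} {L L' : List (Fin s)} (h : L.Perm L') :
    wordExp L = wordExp L' :=
  (h.map _).sum_eq

theorem wordExp_apply_eq_zero {s : ℕ} {j : Fin s} {L : List (Fin s)} (h : j ∉ L) :
    wordExp L j = 0 := by
  induction L with
  | nil => rfl
  | cons i L ih =>
    rw [List.mem_cons, not_or] at h
    simp [ih h.2, h.1]

theorem smon_zero {B : Type*} [Monoid B] {s : ℕ} (x : Fin s → B) : smon x 0 = 1 := by
  refine List.prod_eq_one fun b hb => ?_
  obtain ⟨i, rfl⟩ := List.mem_ofFn.1 hb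
  simp

theorem smon_single_add {B : Type*} [Monoid B] {s : ℕ} (x : Fin s → B) (i : Fin s)
    (β : MIdx s) (h : ∀ j < i, β j = 0) :
    smon x (Pi.single i 1 + β) = x i * smon x β := by
  induction s with
  | zero => exact i.elim0
  | succ s ih =>
    induction i using Fin.cases with
    | zero => simp [smon, List.ofFn_succ, pow_add, mul_assoc]
    | succ k =>
      have h0 : β 0 = 0 := h 0 (Fin.succ_pos k)
      have := ih (fun j => x j.succ) k (fun j => β j.succ)
        fun j hj => h j.succ (Fin.succ_lt_succ_iff.2 hj)
      simp only [smon, Pi.add_apply] at this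
      simp only [smon, List.ofFn_succ, List.prod_cons, Pi.add_apply, h0, pow_zero, one_mul]
      rw [← this]
      simp [Pi.single_apply, Fin.succ_inj, (Fin.succ_ne_zero k).symm]

theorem prod_map_eq_smon {B : Type*} [Monoid B] {s : ℕ} (x : Fin s → B) {L : List (Fin s)}
    (hL : L.Pairwise (· ≤ ·)) : (L.map x).prod = smon x (wordExp L) := by
  induction L with
  | nil => simp [smon_zero]
  | cons i L ih =>
    rw [List.pairwise_cons] at hL
    rw [List.map_cons, List.prod_cons, ih hL.2, wordExp_cons, smon_single_add]
    exact fun j hj => wordExp_apply_eq_zero fun hm => (hL.1 j hm).not_gt hj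

namespace BoundedExt

variable {K : Type*} [CommRing K] {B : Type*} [Ring B] [Algebra K B] {m s n : ℕ}
  (E : BoundedExt K B m s n)

/-- Products of elements of the `F_α(A)` and of the generators `x_i`, in any order, together
with their total weight. -/
inductive IsWord : MIdx n → B → Prop
  | one : IsWord 0 1
  | coeff_mul {α : MIdx m} {a : B} {μ : MIdx n} {b : B} :
      a ∈ E.F α → IsWord μ b → IsWord (E.φ α + μ) (a * b)
  | gen_mul (i : Fin s) {μ : MIdx n} {b : B} :
      IsWord μ b → IsWord (E.ψ (Pi.single i 1) + μ) (E.x i * b)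

variable {E}

theorem IsWord.mul {μ ν : MIdx n} {b c : B} (hb : E.IsWord μ b) (hc : E.IsWord ν c) :
    E.IsWord (μ + ν) (b * c) := by
  induction hb with
  | one => simpa using hc
  | coeff_mul ha _ ih => rw [add_assoc, mul_assoc]; exact .coeff_mul ha ih
  | gen_mul i _ ih => rw [add_assoc, mul_assoc]; exact .gen_mul i ih

theorem isWord_coeff {α : MIdx m} {a : B} (ha : a ∈ E.F α) : E.IsWord (E.φ α) a := by
  simpa using IsWord.coeff_mul ha .one

variable (E) in
theorem isWord_gen (i : Fin s) : E.IsWord (E.ψ (Pi.single i 1)) (E.x i) := by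
  simpa using IsWord.gen_mul (E := E) i .one

theorem IsWord.pow {μ : MIdx n} {b : B} (hb : E.IsWord μ b) (k : ℕ) :
    E.IsWord (k • μ) (b ^ k) := by
  induction k with
  | zero => simpa using IsWord.one
  | succ k ih => rw [succ_nsmul, pow_succ]; exact ih.mul hb

theorem isWord_prod_ofFn {k : ℕ} {f : Fin k → B} {w : Fin k → MIdx n}
    (h : ∀ i, E.IsWord (w i) (f i)) : E.IsWord (∑ i, w i) (List.ofFn f).prod := by
  induction k with
  | zero => simpa using IsWord.one
  | succ k ih =>
    rw [Fin.sum_univ_succ, List.ofFn_succ, List.prod_cons]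
    exact (h 0).mul (ih fun i => h i.succ)

variable (E) in
theorem isWord_smon (β : MIdx s) : E.IsWord (E.ψ β) (smon E.x β) := by
  have hβ : E.ψ β = ∑ i, β i • E.ψ (Pi.single i 1) := by
    conv_lhs => rw [← Finset.univ_sum_single β, map_sum]
    refine Finset.sum_congr rfl fun i _ => ?_
    rw [← map_nsmul, ← Pi.single_smul, smul_eq_mul, mul_one]
  rw [hβ]
  exact isWord_prod_ofFn fun i => (E.isWord_gen i).pow (β i)

variable (E) in
theorem isWord_prod_map (L : List (Fin s)) :
    E.IsWord (E.ψ (wordExp L)) (L.map E.x).prod := by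
  induction L with
  | nil => simpa using IsWord.one
  | cons i L ih =>
    rw [wordExp_cons, map_add, List.map_cons, List.prod_cons]
    exact .gen_mul i ih

variable (E) in
/-- The span of all words whose weight satisfies `P`. -/
def wordSpan (P : MIdx n → Prop) : Submodule K B :=
  Submodule.span K {b | ∃ μ, P μ ∧ E.IsWord μ b}

theorem IsWord.mem_wordSpan {P : MIdx n → Prop} {μ : MIdx n} {b : B} (hb : E.IsWord μ b)
    (hμ : P μ) : b ∈ E.wordSpan P :=
  Submodule.subset_span ⟨μ, hμ, hb⟩

theorem mul_mem_wordSpan {P Q R : MIdx n → Prop} (h : ∀ μ ν, P μ → Q ν → R (μ + ν)) {u v : B}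
    (hu : u ∈ E.wordSpan P) (hv : v ∈ E.wordSpan Q) : u * v ∈ E.wordSpan R := by
  have huv := Submodule.mul_mem_mul hu hv
  rw [wordSpan, wordSpan, Submodule.span_mul_span] at huv
  refine Submodule.span_mono ?_ huv
  rintro _ ⟨b, ⟨μ, hμ, hb⟩, c, ⟨ν, hν, hc⟩, rfl⟩
  exact ⟨μ + ν, h μ ν hμ hν, hb.mul hc⟩

theorem IsWord.mul_mem_wordSpan_lt {μ ν : MIdx n} {b v : B} (hb : E.IsWord μ b)
    (hv : v ∈ E.wordSpan (E.o.lt · ν)) : b * v ∈ E.wordSpan (E.o.lt · (μ + ν)) :=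
  mul_mem_wordSpan (P := (· = μ)) (fun _ _ h₁ h₂ => h₁ ▸ E.o.lt_add_left _ h₂)
    (hb.mem_wordSpan rfl) hv

theorem IsWord.wordSpan_lt_mul_mem {μ ν : MIdx n} {b v : B} (hb : E.IsWord μ b)
    (hv : v ∈ E.wordSpan (E.o.lt · ν)) : v * b ∈ E.wordSpan (E.o.lt · (ν + μ)) :=
  mul_mem_wordSpan (Q := (· = μ)) (fun _ _ h₁ h₂ => h₂ ▸ E.o.lt_add_right _ h₁)
    hv (hb.mem_wordSpan rfl)

theorem monSum_le_wordSpan {P : MIdx m × MIdx s → Prop} {Q : MIdx n → Prop}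
    (h : ∀ γ, P γ → Q (E.φ γ.1 + E.ψ γ.2)) : monSum K B E.F E.x P ≤ E.wordSpan Q := by
  refine iSup₂_le fun γ hγ => ?_
  rintro _ ⟨a, ha, rfl⟩
  exact ((isWord_coeff ha).mul (E.isWord_smon γ.2)).mem_wordSpan (h γ hγ)

/-- Commutation of a generator with a coefficient, up to words of lower weight. -/
theorem exists_gen_mul_coeff (i : Fin s) {α : MIdx m} {a : B} (ha : a ∈ E.F α) :
    ∃ a' ∈ E.F α, E.x i * a - a' * E.x i ∈
      E.wordSpan (E.o.lt · (E.ψ (Pi.single i 1) + E.φ α)) := by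
  obtain ⟨_, ⟨a', ha', rfl⟩, r, hr, h⟩ := Submodule.mem_sup.1 (E.EA3 i α a ha)
  refine ⟨a', ha', ?_⟩
  rw [LinearMap.mulRight_apply] at h
  rw [← h, add_sub_cancel_left, add_comm (E.ψ _)]
  exact monSum_le_wordSpan (fun _ h => h) hr

variable (E) in
/-- Commutation of two generators, up to words of lower weight. -/
theorem exists_gen_mul_gen {i j : Fin s} (hij : i < j) :
    ∃ q ∈ E.F 0, E.x j * E.x i - q * (E.x i * E.x j) ∈
      E.wordSpan (E.o.lt · (E.ψ (Pi.single j 1) + E.ψ (Pi.single i 1))) := by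
  obtain ⟨q, hq, h⟩ := E.EA4 i j hij
  refine ⟨q, hq, ?_⟩
  rw [add_comm, ← map_add]
  exact monSum_le_wordSpan (fun _ h => h) h

variable (E) in
/-- Moving a generator to its sorted position in a monomial, up to words of lower weight. -/
theorem exists_gen_mul_prod (i : Fin s) (L : List (Fin s)) :
    ∃ q ∈ E.F 0, E.x i * (L.map E.x).prod - q * ((L.orderedInsert (· ≤ ·) i).map E.x).prod ∈
      E.wordSpan (E.o.lt · (E.ψ (Pi.single i 1) + E.ψ (wordExp L))) := by
  induction L with
  | nil => exact ⟨1, E.F_one, by simp⟩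
  | cons k L ih =>
    by_cases hik : i ≤ k
    · exact ⟨1, E.F_one, by simp [hik]⟩
    obtain ⟨q, hq, h⟩ := ih
    obtain ⟨p, hp, h'⟩ := E.exists_gen_mul_gen (not_le.1 hik)
    obtain ⟨q', hq', h''⟩ := exists_gen_mul_coeff k hq
    have hpq : p * q' ∈ E.F 0 := by simpa using E.F_mul hp hq'
    have hp0 : E.IsWord 0 p := by simpa using isWord_coeff hp
    refine ⟨p * q', hpq, ?_⟩
    set P := (L.map E.x).prod
    set P' := ((L.orderedInsert (· ≤ ·) i).map E.x).prod with hP'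
    have hins : E.ψ (wordExp (L.orderedInsert (· ≤ ·) i)) =
        E.ψ (Pi.single i 1) + E.ψ (wordExp L) := by
      rw [wordExp_perm (List.perm_orderedInsert _ i L), wordExp_cons, map_add]
    have e : E.x i * ((k :: L).map E.x).prod -
        p * q' * (((k :: L).orderedInsert (· ≤ ·) i).map E.x).prod =
        (E.x i * E.x k - p * (E.x k * E.x i)) * P + p * (E.x k * (E.x i * P - q * P')) +
          p * ((E.x k * q - q' * E.x k) * P') := by
      rw [List.orderedInsert_of_not_le _ L hik]
      simp only [List.map_cons, List.prod_cons, ← hP']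
      noncomm_ring
    rw [e, wordExp_cons, map_add]
    refine add_mem (add_mem ?_ ?_) ?_
    · convert (E.isWord_prod_map L).wordSpan_lt_mul_mem h' using 4
      abel
    · convert hp0.mul_mem_wordSpan_lt ((E.isWord_gen k).mul_mem_wordSpan_lt h) using 4
      abel
    · convert hp0.mul_mem_wordSpan_lt
        ((E.isWord_prod_map (L.orderedInsert (· ≤ ·) i)).wordSpan_lt_mul_mem h'') using 4
      rw [hins, map_zero]
      abel

/-- A word agrees with a standard term of the same weight, up to words of lower weight. -/
theorem IsWord.exists_standard {μ : MIdx n} {b : B} (hb : E.IsWord μ b) :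
    ∃ α, ∃ a ∈ E.F α, ∃ L : List (Fin s), L.Pairwise (· ≤ ·) ∧
      E.φ α + E.ψ (wordExp L) = μ ∧ b - a * (L.map E.x).prod ∈ E.wordSpan (E.o.lt · μ) := by
  induction hb with
  | one => exact ⟨0, 1, E.F_one, [], List.Pairwise.nil, by simp, by simp⟩
  | coeff_mul hc _ ih =>
    obtain ⟨α, a, ha, L, hL, rfl, h⟩ := ih
    refine ⟨_, _, E.F_mul hc ha, L, hL, by rw [map_add, add_assoc], ?_⟩
    rw [mul_assoc, ← mul_sub]
    exact (isWord_coeff hc).mul_mem_wordSpan_lt h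
  | @gen_mul i μ b _ ih =>
    obtain ⟨α, a, ha, L, hL, rfl, h⟩ := ih
    obtain ⟨a', ha', h'⟩ := exists_gen_mul_coeff i ha
    obtain ⟨q, hq, h''⟩ := E.exists_gen_mul_prod i L
    have haq : a' * q ∈ E.F α := by simpa using E.F_mul ha' hq
    refine ⟨α, a' * q, haq, L.orderedInsert (· ≤ ·) i, hL.orderedInsert i L, ?_, ?_⟩
    · rw [wordExp_perm (List.perm_orderedInsert _ i L), wordExp_cons, map_add]
      abel
    set P := (L.map E.x).prod
    set P' := ((L.orderedInsert (· ≤ ·) i).map E.x).prod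
    have e : E.x i * b - a' * q * P' = E.x i * (b - a * P) + (E.x i * a - a' * E.x i) * P +
        a' * (E.x i * P - q * P') := by noncomm_ring
    rw [e]
    refine add_mem (add_mem ((E.isWord_gen i).mul_mem_wordSpan_lt h) ?_) ?_
    · convert (E.isWord_prod_map L).wordSpan_lt_mul_mem h' using 4
      abel
    · convert (isWord_coeff ha').mul_mem_wordSpan_lt h'' using 4
      abel

variable (E) in
theorem tF_mono {μ ν : MIdx n} (h : E.o.le μ ν) : E.tF μ ≤ E.tF ν :=
  biSup_mono fun _ hγ => E.o.le_trans hγ h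

theorem IsWord.mem_tF {μ : MIdx n} {b : B} (hb : E.IsWord μ b) : b ∈ E.tF μ := by
  induction μ using E.o.wellFounded_lt.induction generalizing b with
  | _ μ ih =>
    obtain ⟨α, a, ha, L, hL, hμ, h⟩ := hb.exists_standard
    have hlow : E.wordSpan (E.o.lt · μ) ≤ E.tF μ := by
      refine Submodule.span_le.2 ?_
      rintro c ⟨κ, hκ, hc⟩
      exact E.tF_mono hκ.1 (ih κ hκ hc)
    rw [← sub_add_cancel b (a * (L.map E.x).prod)]
    refine add_mem (hlow h) ?_
    rw [prod_map_eq_smon E.x hL]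
    have hw : E.o.le (E.wt (α, wordExp L)) μ := hμ ▸ E.o.le_refl _
    exact Submodule.mem_iSup_of_mem (α, wordExp L)
      (Submodule.mem_iSup_of_mem hw ⟨a, ha, rfl⟩)

variable (E) in
theorem tF_eq_wordSpan (γ : MIdx n) : E.tF γ = E.wordSpan (E.o.le · γ) := by
  refine le_antisymm (monSum_le_wordSpan fun _ h => h) (Submodule.span_le.2 ?_)
  rintro b ⟨μ, hμ, hb⟩
  exact E.tF_mono hμ hb.mem_tF

end BoundedExt

/-- For a `(φ,ψ)`-bounded extension `A ⊆ B`, the family `F̃` is multiplicative: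
`F̃_γ(B) · F̃_δ(B) ⊆ F̃_{γ+δ}(B)` for all `γ, δ ∈ ℕ^n`. -/
theorem boundedExt_tF_mul {K : Type*} [CommRing K] {B : Type*} [Ring B]
    [Algebra K B] {m s n : ℕ} (E : BoundedExt K B m s n) :
    ∀ γ δ : MIdx n, ∀ u ∈ E.tF γ, ∀ v ∈ E.tF δ, u * v ∈ E.tF (γ + δ) := by
  intro γ δ u hu v hv
  rw [E.tF_eq_wordSpan] at hu hv ⊢
  exact BoundedExt.mul_mem_wordSpan (P := (E.o.le · γ)) (Q := (E.o.le · δ))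
    (R := (E.o.le · (γ + δ))) (fun _ _ h₁ h₂ => E.o.add_le_add h₁ h₂) hu hv
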